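/- arXiv:2504.03901 — 5 statements merged into one kernel-verified Lean document; each statement's English description precedes it below -/
import Mathlib

section
/- Let a ∈ ℕ, let b be a positive integer, and let m ∈ ℕ. Then ∫_{−1}^{1} (1 − x)^a (1 + x)^{b−1} (P_m^{(a,b)}(x))² dx = (2^{a+b}/b) · Γ(a + m + 1)·Γ(b + m + 1)/(m!·Γ(a + b + m + 1)). -/
/-- The Jacobi polynomial `P_n^{(a,b)}` with nonnegative integer parameters,
as a function on `ℝ`. -/
noncomputable def jacobiP (n a b : ℕ) (x : ℝ) : ℝ :=
  ∑ k ∈ Finset.range (n + 1),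
    (Nat.choose (n + a) (n - k) : ℝ) * (Nat.choose (n + b) k : ℝ) *
      ((x - 1) / 2) ^ k * ((x + 1) / 2) ^ (n - k)

open Polynomial in
/-- The shifted Jacobi polynomial. -/
noncomputable def jacQ (m a b : ℕ) : Polynomial ℝ :=
  ∑ i ∈ Finset.range (m + 1),
    C ((Nat.choose (m + a) i : ℝ) * (Nat.choose (m + b) (m - i) : ℝ)) *
      (X - 1) ^ (m - i) * X ^ i

lemma jacQ_eval (m a b : ℕ) (t : ℝ) : (jacQ m a b).eval t =
    ∑ i ∈ Finset.range (m + 1), (Nat.choose (m + a) i : ℝ) * (Nat.choose (m + b) (m - i) : ℝ) *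
      (t - 1) ^ (m - i) * t ^ i := by
  simp [jacQ, Polynomial.eval_finsetSum]

lemma jacobiP_eq (m a b : ℕ) (t : ℝ) : jacobiP m a b (2 * t - 1) = (jacQ m a b).eval t := by
  rw [jacQ_eval, jacobiP, ← Finset.sum_range_reflect]
  refine Finset.sum_congr rfl fun i hi => ?_
  have hi' : i ≤ m := Nat.lt_succ_iff.mp (Finset.mem_range.mp hi)
  have e1 : m + 1 - 1 - i = m - i := by omega
  have e2 : m - (m - i) = i := by omega
  rw [e1, e2]
  congr 2
  · congr 1; ring
  · ring

lemma jacQ_natDegree (m a b : ℕ) : (jacQ m a b).natDegree ≤ m := by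
  refine Polynomial.natDegree_sum_le_of_forall_le _ _ fun i hi => ?_
  have hi' : i ≤ m := Nat.lt_succ_iff.mp (Finset.mem_range.mp hi)
  have h1 : ((Polynomial.X - 1 : Polynomial ℝ) ^ (m - i)).natDegree ≤ m - i := by
    refine (Polynomial.natDegree_pow_le).trans ?_
    have : (Polynomial.X - 1 : Polynomial ℝ).natDegree ≤ 1 := by
      compute_degree
    nlinarith
  refine (Polynomial.natDegree_mul_le).trans ?_
  rw [Polynomial.natDegree_X_pow]
  have := Polynomial.natDegree_C_mul_le
    ((Nat.choose (m + a) i : ℝ) * (Nat.choose (m + b) (m - i) : ℝ))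
    ((Polynomial.X - 1 : Polynomial ℝ) ^ (m - i))
  omega

lemma jacQ_zero (m a b : ℕ) : (jacQ m a b).coeff 0 = (-1) ^ m * (Nat.choose (m + b) m : ℝ) := by
  rw [Polynomial.coeff_zero_eq_eval_zero, jacQ_eval, Finset.sum_range_succ']
  simp [mul_comm]

lemma beta_nat (p q : ℕ) : ∫ t in (0 : ℝ)..1, t ^ p * (1 - t) ^ q =
    (p.factorial * q.factorial : ℝ) / (p + q + 1).factorial := by
  induction q generalizing p with
  | zero =>
    simp only [pow_zero, mul_one, integral_pow, add_zero, Nat.factorial_succ]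
    have := Nat.factorial_ne_zero p
    push_cast
    field_simp
    simp
  | succ q ih =>
    have hd : ∀ t ∈ Set.uIcc (0 : ℝ) 1, HasDerivAt (fun t : ℝ => t ^ (p + 1) * (1 - t) ^ (q + 1))
        (((p : ℝ) + 1) * (t ^ p * (1 - t) ^ (q + 1)) - ((q : ℝ) + 1) * (t ^ (p + 1) * (1 - t) ^ q))
        t := by
      intro t _
      have h1 := (hasDerivAt_id t).pow (p + 1)
      have h2 := ((hasDerivAt_id t).const_sub 1).pow (q + 1)
      convert! h1.mul h2 using 1
      simp
      ring
    have h := intervalIntegral.integral_eq_sub_of_hasDerivAt hd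
      (Continuous.intervalIntegrable (by fun_prop) _ _)
    rw [intervalIntegral.integral_sub (Continuous.intervalIntegrable (by fun_prop) _ _)
      (Continuous.intervalIntegrable (by fun_prop) _ _), intervalIntegral.integral_const_mul,
      intervalIntegral.integral_const_mul, ih] at h
    have e : p + 1 + q + 1 = p + (q + 1) + 1 := by ring
    rw [e] at h
    have hp : (p : ℝ) + 1 ≠ 0 := by positivity
    apply mul_left_cancel₀ hp
    rw [sub_eq_iff_eq_add.mp h, Nat.factorial_succ p, Nat.factorial_succ q]
    push_cast
    simp
    ring

lemma moment (m a b s : ℕ) : ∫ t in (0 : ℝ)..1, t ^ s * (1 - t) ^ a * (jacQ m a b).eval t =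
    ((m + a).factorial * (m + b).factorial : ℝ) / (m.factorial * (a + m + s + 1).factorial) *
    ∑ i ∈ Finset.range (m + 1), (-1) ^ (m - i) * (Nat.choose m i : ℝ) *
      ((s + i).factorial / (b + i).factorial) := by
  have : ∀ t : ℝ, t ^ s * (1 - t) ^ a * (jacQ m a b).eval t =
      ∑ i ∈ Finset.range (m + 1), ((Nat.choose (m + a) i : ℝ) * (Nat.choose (m + b) (m - i) : ℝ) *
      (-1) ^ (m - i)) * (t ^ (s + i) * (1 - t) ^ (a + (m - i))) := by
    intro t
    rw [jacQ_eval, Finset.mul_sum]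
    refine Finset.sum_congr rfl fun i hi => ?_
    have : t - 1 = (-1) * (1 - t) := by ring
    rw [this, mul_pow, pow_add, pow_add]
    ring
  simp_rw [this]
  rw [intervalIntegral.integral_finsetSum
    (fun i _ => Continuous.intervalIntegrable (by fun_prop) _ _), Finset.mul_sum]
  refine Finset.sum_congr rfl fun i hi => ?_
  have hi' : i ≤ m := Nat.lt_succ_iff.mp (Finset.mem_range.mp hi)
  rw [intervalIntegral.integral_const_mul, beta_nat]
  obtain ⟨k, rfl⟩ := Nat.exists_eq_add_of_le hi'
  have e1 : i + k - i = k := by omega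
  have e2 : s + i + (a + k) + 1 = a + (i + k) + s + 1 := by ring
  rw [e1, e2, Nat.cast_choose ℝ (show i ≤ i + k + a by omega),
    Nat.cast_choose ℝ (show k ≤ i + k + b by omega), Nat.cast_choose ℝ (show i ≤ i + k by omega)]
  have e3 : i + k + a - i = a + k := by omega
  have e4 : i + k + b - k = b + i := by omega
  rw [e1, e3, e4]
  have h1 := Nat.factorial_ne_zero i
  have h2 := Nat.factorial_ne_zero k
  have h3 := Nat.factorial_ne_zero (i + k)
  have h4 := Nat.factorial_ne_zero (a + k)
  have h5 := Nat.factorial_ne_zero (b + i)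
  have h6 := Nat.factorial_ne_zero (a + (i + k) + s + 1)
  field_simp

lemma moment_zero (m a b j : ℕ) (hj : j < m) :
    ∫ t in (0 : ℝ)..1, t ^ (b + j) * (1 - t) ^ a * (jacQ m a b).eval t = 0 := by
  rw [moment]
  have hdeg : (ascPochhammer ℝ j).natDegree < m := by rwa [ascPochhammer_natDegree]
  have h := congrFun (Polynomial.fwdDiff_iter_eq_zero_of_degree_lt hdeg) ((b : ℝ) + 1)
  rw [fwdDiff_iter_eq_sum_shift] at h
  refine mul_eq_zero_of_right _ (Eq.trans ?_ h)
  refine Finset.sum_congr rfl fun i hi => ?_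
  have e : (b : ℝ) + 1 + i • (1 : ℝ) = ((b + i + 1 : ℕ) : ℝ) := by
    simp; ring
  rw [e, ascPochhammer_nat_eq_natCast_ascFactorial, zsmul_eq_mul]
  have h2 := Nat.factorial_mul_ascFactorial (b + i) j
  have e2 : b + j + i = b + i + j := by ring
  rw [e2, ← h2]
  have h5 := Nat.factorial_ne_zero (b + i)
  push_cast
  field_simp

lemma moment_one (m a c : ℕ) :
    ∫ t in (0 : ℝ)..1, t ^ c * (1 - t) ^ a * (jacQ m a (c + 1)).eval t =
    ((m + a).factorial * (m + (c + 1)).factorial : ℝ) / (m.factorial * (a + m + c + 1).factorial) *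
    ((-1) ^ m * ((c.factorial * m.factorial : ℝ) / (c + m + 1).factorial)) := by
  rw [moment]
  congr 1
  rw [← beta_nat, ← intervalIntegral.integral_const_mul]
  have : ∀ t : ℝ, (-1) ^ m * (t ^ c * (1 - t) ^ m) = ∑ i ∈ Finset.range (m + 1),
      ((-1) ^ (m - i) * (Nat.choose m i : ℝ)) * t ^ (c + i) := by
    intro t
    have e : (-1) ^ m * (t ^ c * (1 - t) ^ m) = t ^ c * (t + (-1)) ^ m := by
      rw [show t + (-1) = (-1) * (1 - t) by ring, mul_pow]; ring
    rw [e, add_pow, Finset.mul_sum]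
    refine Finset.sum_congr rfl fun i hi => ?_
    rw [pow_add]; ring
  simp_rw [this]
  rw [intervalIntegral.integral_finsetSum
    (fun i _ => Continuous.intervalIntegrable (by fun_prop) _ _)]
  refine Finset.sum_congr rfl fun i hi => ?_
  rw [intervalIntegral.integral_const_mul, integral_pow]
  congr 1
  have e : c + 1 + i = c + i + 1 := by ring
  rw [e, Nat.factorial_succ]
  have h5 := Nat.factorial_ne_zero (c + i)
  push_cast
  simp
  field_simp

lemma orth (m a b : ℕ) : ∫ t in (0 : ℝ)..1,
    t ^ b * (1 - t) ^ a * (jacQ m a b).eval t * (jacQ m a b).divX.eval t = 0 := by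
  rcases Nat.eq_zero_or_pos m with rfl | hm
  · have : (jacQ 0 a b).divX = 0 := by
      simp [jacQ]
    simp [this]
  have hd : (jacQ m a b).divX.natDegree < m := by
    rw [Polynomial.natDegree_divX_eq_natDegree_tsub_one]
    have := jacQ_natDegree m a b
    omega
  have : ∀ t : ℝ, t ^ b * (1 - t) ^ a * (jacQ m a b).eval t * (jacQ m a b).divX.eval t =
      ∑ j ∈ Finset.range m, (jacQ m a b).divX.coeff j *
        (t ^ (b + j) * (1 - t) ^ a * (jacQ m a b).eval t) := by
    intro t
    rw [Polynomial.eval_eq_sum_range' hd t, Finset.mul_sum]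
    refine Finset.sum_congr rfl fun i hi => ?_
    rw [pow_add]; ring
  simp_rw [this]
  rw [intervalIntegral.integral_finsetSum
    (fun i _ => Continuous.intervalIntegrable (by fun_prop) _ _)]
  refine Finset.sum_eq_zero fun i hi => ?_
  rw [intervalIntegral.integral_const_mul, moment_zero m a b i (Finset.mem_range.mp hi), mul_zero]

lemma norm01 (m a c : ℕ) :
    ∫ t in (0 : ℝ)..1, t ^ c * (1 - t) ^ a * ((jacQ m a (c + 1)).eval t) ^ 2 =
    ((m + a).factorial * (m + (c + 1)).factorial : ℝ) / (m.factorial * (a + m + c + 1).factorial) /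
      (c + 1) := by
  have : ∀ t : ℝ, t ^ c * (1 - t) ^ a * ((jacQ m a (c + 1)).eval t) ^ 2 =
      (jacQ m a (c + 1)).coeff 0 * (t ^ c * (1 - t) ^ a * (jacQ m a (c + 1)).eval t) +
      t ^ (c + 1) * (1 - t) ^ a * (jacQ m a (c + 1)).eval t * (jacQ m a (c + 1)).divX.eval t := by
    intro t
    have h := congrArg (Polynomial.eval t) (Polynomial.divX_mul_X_add (jacQ m a (c + 1)))
    simp only [Polynomial.eval_add, Polynomial.eval_mul, Polynomial.eval_X,
      Polynomial.eval_C] at h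
    rw [pow_two]
    nth_rewrite 1 [← h]
    ring
  simp_rw [this]
  rw [intervalIntegral.integral_add (Continuous.intervalIntegrable (by fun_prop) _ _)
    (Continuous.intervalIntegrable (by fun_prop) _ _), orth, intervalIntegral.integral_const_mul,
    moment_one, jacQ_zero, Nat.cast_choose ℝ (show m ≤ m + (c + 1) by omega)]
  have e1 : m + (c + 1) - m = c + 1 := by omega
  have e2 : c + m + 1 = m + (c + 1) := by ring
  rw [e1, e2, Nat.factorial_succ c]
  have h1 := Nat.factorial_ne_zero c
  have h2 := Nat.factorial_ne_zero m
  have h3 := Nat.factorial_ne_zero (m + (c + 1))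
  have h4 := Nat.factorial_ne_zero (a + m + c + 1)
  have h5 : ((-1 : ℝ) ^ m) ^ 2 = 1 := by rw [← pow_mul, mul_comm, pow_mul]; simp
  push_cast
  field_simp
  simp [h5]

/-- Gradshteyn–Ryzhik identity 7.391:
`∫_{−1}^{1} (1−x)^a (1+x)^{b−1} (P_m^{(a,b)}(x))² dx
  = (2^{a+b}/b) Γ(a+m+1)Γ(b+m+1)/(m! Γ(a+b+m+1))`. -/
theorem jacobi_weighted_norm_integral
    (a : ℕ) (b : ℕ) (hb : 1 ≤ b) (m : ℕ) :
    ∫ x in (-1 : ℝ)..1, (1 - x) ^ a * (1 + x) ^ (b - 1) * (jacobiP m a b x) ^ 2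
      = (2 : ℝ) ^ (a + b) / b *
          (Real.Gamma ((a : ℝ) + m + 1) * Real.Gamma ((b : ℝ) + m + 1) /
            (m.factorial * Real.Gamma ((a : ℝ) + b + m + 1))) := by
  obtain ⟨c, rfl⟩ : ∃ c, b = c + 1 := ⟨b - 1, by omega⟩
  have hsub := intervalIntegral.smul_integral_comp_mul_sub (a := 0) (b := 1)
    (fun x : ℝ => (1 - x) ^ a * (1 + x) ^ (c + 1 - 1) * (jacobiP m a (c + 1) x) ^ 2) 2 1
  norm_num at hsub
  simp only [Nat.add_sub_cancel]
  rw [← hsub]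
  have : ∀ t : ℝ, (1 - (2 * t - 1)) ^ a * (2 * t) ^ c * (jacobiP m a (c + 1) (2 * t - 1)) ^ 2 =
      2 ^ (a + c) * (t ^ c * (1 - t) ^ a * ((jacQ m a (c + 1)).eval t) ^ 2) := by
    intro t
    rw [jacobiP_eq, show 1 - (2 * t - 1) = 2 * (1 - t) by ring, mul_pow, mul_pow, pow_add]
    ring
  simp_rw [this]
  rw [intervalIntegral.integral_const_mul, norm01]
  have g1 : Real.Gamma ((a : ℝ) + m + 1) = (m + a).factorial := by
    rw [← Real.Gamma_nat_eq_factorial]; congr 1; push_cast; ring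
  have g2 : Real.Gamma (((c + 1 : ℕ) : ℝ) + m + 1) = (m + (c + 1)).factorial := by
    rw [← Real.Gamma_nat_eq_factorial]; congr 1; push_cast; ring
  have g3 : Real.Gamma ((a : ℝ) + ((c + 1 : ℕ) : ℝ) + m + 1) = (a + m + c + 1).factorial := by
    rw [← Real.Gamma_nat_eq_factorial]; congr 1; push_cast; ring
  rw [g1, g2, g3]
  push_cast
  ring
end

section
/- Let a, b ∈ ℕ and n ∈ ℕ. For every polynomial p of degree strictly less than n, ∫_{−1}^{1} (1 − x)^a (1 + x)^b p(x) P_n^{(a,b)}(x) dx = 0. In particular, ∫_{−1}^{1} (1 − x)^a (1 + x)^b x^r P_n^{(a,b)}(x) dx = 0 for all r = 0, 1, …, n − 1. -/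
open Polynomial in
theorem jacobi_aux_int (Q : Polynomial ℝ) (n : ℕ)
    (h1 : ∀ j < n, (derivative^[j] Q).eval 1 = 0)
    (h2 : ∀ j < n, (derivative^[j] Q).eval (-1) = 0) :
    ∀ p : Polynomial ℝ, p.degree < n →
      ∫ x in (-1 : ℝ)..1, p.eval x * (derivative^[n] Q).eval x = 0 := by
  induction n with
  | zero =>
    intro p hp
    have : p = 0 := by
      rw [← degree_eq_bot]
      simpa [Nat.WithBot.lt_zero_iff] using hp
    simp [this]
  | succ n ih =>
    intro p hp
    have hd : (derivative p).degree < n := by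
      by_cases h0 : p = 0
      · simp [h0]
      · have hl := degree_derivative_lt h0
        have hp' : p.degree ≤ n := by
          rw [degree_eq_natDegree h0] at hp ⊢
          norm_cast at hp ⊢
          omega
        exact lt_of_lt_of_le hl hp'
    have key := intervalIntegral.integral_mul_deriv_eq_deriv_mul
      (a := (-1 : ℝ)) (b := 1) (u := fun x => p.eval x) (u' := fun x => (derivative p).eval x)
      (v := fun x => (derivative^[n] Q).eval x)
      (v' := fun x => (derivative^[n+1] Q).eval x)
      (fun x _ => p.hasDerivAt x)
      (fun x _ => by
        rw [Function.iterate_succ_apply']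
        exact (derivative^[n] Q).hasDerivAt x)
      ((derivative p).continuous.intervalIntegrable _ _)
      ((derivative^[n+1] Q).continuous.intervalIntegrable _ _)
    rw [key, ih (fun j hj => h1 j (by omega)) (fun j hj => h2 j (by omega)) _ hd,
      h1 n (by omega), h2 n (by omega)]
    simp

open Polynomial in
theorem jacobi_aux_rodrigues (a b n : ℕ) (x : ℝ) :
    (derivative^[n] ((X - C (1:ℝ)) ^ (n + a) * (X + C (1:ℝ)) ^ (n + b))).eval x =
      (n.factorial * 2 ^ n * (-1) ^ a) * ((1 - x) ^ a * (1 + x) ^ b * jacobiP n a b x) := by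
  rw [iterate_derivative_mul, eval_finsetSum, jacobiP, Finset.mul_sum, Finset.mul_sum]
  refine Finset.sum_congr rfl fun k hk => ?_
  have hk : k ≤ n := by simpa [Nat.lt_succ_iff] using hk
  rw [iterate_derivative_X_sub_pow, iterate_derivative_X_add_pow]
  simp only [eval_natCast, eval_mul, eval_pow, eval_sub, eval_add, eval_X, eval_C, nsmul_eq_mul,
    Nat.descFactorial_eq_factorial_mul_choose]
  obtain ⟨m, rfl⟩ := Nat.exists_eq_add_of_le hk
  have e1 : k + m + a - (k + m - k) = a + k := by omega
  have e2 : k + m + b - k = b + m := by omega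
  have e3 : k + m - k = m := by omega
  rw [e1, e2, e3]
  have hc : (((k + m).choose k : ℕ) : ℝ) * k.factorial * m.factorial = (k + m).factorial := by
    have := Nat.choose_mul_factorial_mul_factorial hk
    rw [e3] at this
    exact_mod_cast this
  have hs : (1 - x) ^ a = (-1) ^ a * (x - 1) ^ a := by rw [← mul_pow]; ring
  have hone : ((-1 : ℝ) ^ a) * (-1) ^ a = 1 := by rw [← mul_pow]; simp
  rw [← hc, hs, div_pow, div_pow, pow_add 2]
  simp only [Nat.cast_mul]
  field_simp
  have hsq : (((-1 : ℝ) ^ a)) ^ 2 = 1 := by rw [sq, hone]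
  ring_nf
  ring_nf at hsq
  simp only [hsq]
  ring

open Polynomial in
theorem jacobi_aux_main (a b n : ℕ) (p : Polynomial ℝ) (hp : p.degree < n) :
      ∫ x in (-1 : ℝ)..1,
        (1 - x) ^ a * (1 + x) ^ b * p.eval x * jacobiP n a b x = 0 := by
  have h := jacobi_aux_int ((X - C (1:ℝ)) ^ (n + a) * (X + C (1:ℝ)) ^ (n + b)) n
    (fun j hj => by
      have hd := pow_sub_dvd_iterate_derivative_of_pow_dvd j
        (Dvd.intro ((X + C (1:ℝ)) ^ (n + b)) rfl :
          (X - C (1:ℝ)) ^ (n + a) ∣ (X - C (1:ℝ)) ^ (n + a) * (X + C (1:ℝ)) ^ (n + b))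
      obtain ⟨q, hq⟩ := hd
      have : n + a - j ≠ 0 := by omega
      rw [hq]
      simp [this])
    (fun j hj => by
      have hd := pow_sub_dvd_iterate_derivative_of_pow_dvd j
        (Dvd.intro_left ((X - C (1:ℝ)) ^ (n + a)) rfl :
          (X + C (1:ℝ)) ^ (n + b) ∣ (X - C (1:ℝ)) ^ (n + a) * (X + C (1:ℝ)) ^ (n + b))
      obtain ⟨q, hq⟩ := hd
      have : n + b - j ≠ 0 := by omega
      rw [hq]
      simp [this]) p hp
  simp only [jacobi_aux_rodrigues] at h
  have hc : ((n.factorial : ℝ) * 2 ^ n * (-1) ^ a) ≠ 0 := by positivity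
  have e : ∀ x : ℝ, p.eval x * ((n.factorial * 2 ^ n * (-1) ^ a) *
      ((1 - x) ^ a * (1 + x) ^ b * jacobiP n a b x)) = (n.factorial * 2 ^ n * (-1) ^ a) *
      ((1 - x) ^ a * (1 + x) ^ b * p.eval x * jacobiP n a b x) := fun x => by ring
  simp only [e, intervalIntegral.integral_const_mul] at h
  exact (mul_eq_zero.mp h).resolve_left hc

theorem jacobi_orthogonal_to_lower_degree (a b n : ℕ) :
    (∀ p : Polynomial ℝ, p.degree < n →
      ∫ x in (-1 : ℝ)..1,
        (1 - x) ^ a * (1 + x) ^ b * p.eval x * jacobiP n a b x = 0) ∧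
    (∀ r : ℕ, r < n →
      ∫ x in (-1 : ℝ)..1,
        (1 - x) ^ a * (1 + x) ^ b * x ^ r * jacobiP n a b x = 0) := by
  refine ⟨jacobi_aux_main a b n, fun r hr => ?_⟩
  have h := jacobi_aux_main a b n (Polynomial.X ^ r)
    (by rw [Polynomial.degree_X_pow]; exact_mod_cast hr)
  simpa using h
end

section
/- Let a ∈ ℕ, let b and s be positive integers, and let m ∈ ℕ. Then ∫_{−1}^{1} (1 − x)^a (1 + x)^{b+s−1} P_m^{(a, b+2s)}(x) P_{m+s}^{(a, b)}(x) dx = 0. -/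
open Polynomial in
/-- Iterated integration by parts against a polynomial killed by `D^n`. -/
theorem integral_iterate_derivative_mul_eq_zero (n : ℕ) :
    ∀ (G q : ℝ[X]), (X - C (1 : ℝ)) ^ n ∣ G → (X - C (-1 : ℝ)) ^ n ∣ G →
      derivative^[n] q = 0 →
      ∫ x in (-1 : ℝ)..1, q.eval x * (derivative^[n] G).eval x = 0 := by
  induction n with
  | zero =>
    intro G q _ _ hq
    simp only [Function.iterate_zero, id] at hq
    simp [hq]
  | succ n ih =>
    intro G q h1 h2 hq
    have key : ∀ c : ℝ, (X - C c) ^ (n + 1) ∣ G → (derivative^[n] G).eval c = 0 := by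
      intro c hc
      have h := pow_sub_dvd_iterate_derivative_of_pow_dvd n hc
      rw [Nat.add_sub_cancel_left, pow_one] at h
      exact dvd_iff_isRoot.mp h
    have hI := intervalIntegral.integral_mul_deriv_eq_deriv_mul (a := (-1 : ℝ)) (b := 1)
      (u := fun x => q.eval x) (u' := fun x => (derivative q).eval x)
      (v := fun x => (derivative^[n] G).eval x)
      (v' := fun x => (derivative^[n + 1] G).eval x)
      (fun x _ => q.hasDerivAt x)
      (fun x _ => by
        rw [Function.iterate_succ_apply']
        exact (derivative^[n] G).hasDerivAt x)
      ((derivative q).continuous.intervalIntegrable _ _)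
      ((derivative^[n + 1] G).continuous.intervalIntegrable _ _)
    rw [hI]
    simp only [key 1 h1, key (-1) h2]
    rw [ih G (derivative q) ((pow_dvd_pow _ n.le_succ).trans h1)
      ((pow_dvd_pow _ n.le_succ).trans h2) (by rwa [Function.iterate_succ_apply] at hq)]
    simp

open Polynomial in
/-- Rodrigues' formula. -/
theorem rodrigues_jacobiP (n a b : ℕ) (x : ℝ) :
    (derivative^[n] ((X - C (1 : ℝ)) ^ (n + a) * (X - C (-1 : ℝ)) ^ (n + b))).eval x =
      (n.factorial : ℝ) * 2 ^ n * ((x - 1) ^ a * (x + 1) ^ b * jacobiP n a b x) := by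
  rw [iterate_derivative_mul, eval_finsetSum, jacobiP, Finset.mul_sum, Finset.mul_sum]
  refine Finset.sum_congr rfl fun k hk => ?_
  have hk' : k ≤ n := Nat.lt_succ_iff.mp (Finset.mem_range.mp hk)
  obtain ⟨j, rfl⟩ := Nat.exists_eq_add_of_le hk'
  rw [iterate_derivative_X_sub_pow, iterate_derivative_X_sub_pow]
  have e1 : k + j - k = j := by omega
  have e2 : k + j + a - j = k + a := by omega
  have e3 : k + j + b - k = j + b := by omega
  have hf : (((k + j).factorial : ℕ) : ℝ) =
      ((k + j).choose k : ℝ) * (k.factorial : ℝ) * (j.factorial : ℝ) := by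
    have := Nat.choose_mul_factorial_mul_factorial hk'
    rw [e1] at this
    exact_mod_cast this.symm
  rw [e1, e2, e3, Nat.descFactorial_eq_factorial_mul_choose,
    Nat.descFactorial_eq_factorial_mul_choose, hf]
  simp only [eval_natCast, eval_mul, eval_pow, eval_sub, eval_X, eval_C, nsmul_eq_mul, div_pow,
    sub_neg_eq_add, Nat.cast_mul, pow_add]
  field_simp
  try ring

open Polynomial in
/-- Up to a power of `1 + x`, a Jacobi polynomial is a polynomial of bounded degree. -/
theorem exists_poly_jacobiP (m a b t : ℕ) :
    ∃ q : ℝ[X], q.natDegree ≤ m + t ∧ ∀ x, q.eval x = (1 + x) ^ t * jacobiP m a b x := by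
  refine ⟨(C 1 + X) ^ t * ∑ k ∈ Finset.range (m + 1),
    C ((Nat.choose (m + a) (m - k) : ℝ) * (Nat.choose (m + b) k : ℝ)) *
      (C (1 / 2) * (X - C 1)) ^ k * (C (1 / 2) * (X + C 1)) ^ (m - k), ?_, ?_⟩
  · rw [add_comm m t]
    refine natDegree_mul_le_of_le ?_ (natDegree_sum_le_of_forall_le _ _ fun k hk => ?_)
    · compute_degree
    · have hk' : k ≤ m := Nat.lt_succ_iff.mp (Finset.mem_range.mp hk)
      have h1 : (C (1 / 2 : ℝ) * (X - C 1)).natDegree ≤ 1 := by compute_degree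
      have h2 : (C (1 / 2 : ℝ) * (X + C 1)).natDegree ≤ 1 := by compute_degree
      have h3 := natDegree_pow_le_of_le k h1
      have h4 := natDegree_pow_le_of_le (m - k) h2
      have := natDegree_mul_le_of_le (natDegree_mul_le_of_le
        (natDegree_C ((Nat.choose (m + a) (m - k) : ℝ) * (Nat.choose (m + b) k : ℝ))).le h3) h4
      omega
  · intro x
    rw [eval_mul, eval_finsetSum, jacobiP]
    simp [div_eq_inv_mul]

/-- Vanishing of the cross integral of Jacobi polynomials of different
parameters occurring in the orthogonality of matrix elements of two distinct
discrete-series UIRs of SU(1,1):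
`∫_{−1}^{1} (1−x)^a (1+x)^{b+s−1} P_m^{(a,b+2s)}(x) P_{m+s}^{(a,b)}(x) dx = 0`. -/
theorem jacobi_cross_integral_vanishes
    (a : ℕ) (b s : ℕ) (hb : 1 ≤ b) (hs : 1 ≤ s) (m : ℕ) :
    ∫ x in (-1 : ℝ)..1,
      (1 - x) ^ a * (1 + x) ^ (b + s - 1) *
        jacobiP m a (b + 2 * s) x * jacobiP (m + s) a b x = 0 := by
  obtain ⟨q, hq, hqe⟩ := exists_poly_jacobiP m a (b + 2 * s) (s - 1)
  have h := integral_iterate_derivative_mul_eq_zero (m + s) _ q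
    (Dvd.dvd.mul_right (pow_dvd_pow _ (Nat.le_add_right (m + s) a)) _)
    (Dvd.dvd.mul_left (pow_dvd_pow _ (Nat.le_add_right (m + s) b)) _)
    (Polynomial.iterate_derivative_eq_zero (by omega))
  have hc : (((m + s).factorial : ℝ) * 2 ^ (m + s)) ≠ 0 := by positivity
  have e : b + s - 1 = b + (s - 1) := by omega
  have hfun : ∀ x : ℝ, (1 - x) ^ a * (1 + x) ^ (b + s - 1) *
        jacobiP m a (b + 2 * s) x * jacobiP (m + s) a b x =
      ((-1) ^ a * (((m + s).factorial : ℝ) * 2 ^ (m + s))⁻¹) *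
        (q.eval x * (Polynomial.derivative^[m + s]
          ((Polynomial.X - Polynomial.C (1 : ℝ)) ^ (m + s + a) *
            (Polynomial.X - Polynomial.C (-1 : ℝ)) ^ (m + s + b))).eval x) := by
    intro x
    rw [rodrigues_jacobiP, hqe, e, pow_add, show (1 - x) = (-1) * (x - 1) by ring, mul_pow,
      add_comm x 1]
    field_simp
  simp_rw [hfun]
  rw [intervalIntegral.integral_const_mul, h, mul_zero]
end

section
/- Let 2η₁ and 2η₂ be integers with 2η₁, 2η₂ ≥ 2, and let m, m′, n, n′ ∈ ℕ with m′ ≥ m and n′ ≥ n. Define, for x ∈ (−1, 1), φ ∈ [0, 2π], ψ ∈ [−2π, 2π], F^{η}_{k,k′}(x, φ, ψ) = 2^{(k−k′)/2 − η} ( k!·Γ(2η + k′) / (k′!·Γ(2η + k)) )^{1/2} (1 − x)^{(k′−k)/2} (1 + x)^{η} P_k^{(k′−k, 2η−1)}(x) (−1)^{k′−k} e^{−i(η+k)φ} e^{−i(η+k′)ψ} (for k′ ≥ k). Then (1/(2π²)) ∫_{−1}^{1} ∫_{0}^{2π} ∫_{−2π}^{2π} F^{η₁}_{m,m′}(x,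 φ, ψ) · \overline{F^{η₂}_{n,n′}(x, φ, ψ)} · (1 + x)^{−2} dψ dφ dx = (2/(2η₁ − 1)) · δ_{η₁ η₂} · δ_{mn} · δ_{m′n′}. (This is the orthogonality relation ∫_{SU(1,1)} U^{η₁}_{mm′}(g) \overline{U^{η₂}_{nn′}(g)} d_{Haar}(g) = d_{η₁} δ_{η₁η₂} δ_{mn} δ_{m′n′}, with d_η = 2/(2η−1), expressed in Cartan coordinates.) -/
open Complex

/-- The matrix element `U^η_{kk′}(g)` (for `k′ ≥ k`, `η = twoEta/2`) of the
holomorphic discrete series of SU(1,1), expressed in the Cartan coordinates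
`(x, φ, ψ)`. -/
noncomputable def su11MatrixElement (twoEta k k' : ℕ) (x φ ψ : ℝ) : ℂ :=
  (((2 : ℝ) ^ (((k : ℝ) - (k' : ℝ)) / 2 - (twoEta : ℝ) / 2) *
      Real.sqrt (k.factorial * Real.Gamma ((twoEta : ℝ) + k') /
        (k'.factorial * Real.Gamma ((twoEta : ℝ) + k))) *
      (1 - x) ^ (((k' : ℝ) - (k : ℝ)) / 2) *
      (1 + x) ^ ((twoEta : ℝ) / 2) *
      jacobiP k (k' - k) (twoEta - 1) x : ℝ) : ℂ) *
    (-1 : ℂ) ^ (k' - k) *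
    Complex.exp (-Complex.I * (((twoEta : ℝ) / 2 + k : ℝ) : ℂ) * (φ : ℂ)) *
    Complex.exp (-Complex.I * (((twoEta : ℝ) / 2 + k' : ℝ) : ℂ) * (ψ : ℂ))

/-- The beta integral with natural exponents. -/
lemma su11_beta (p q : ℕ) : ∫ t in (0 : ℝ)..1, t ^ p * (1 - t) ^ q
    = (p.factorial : ℝ) * q.factorial / (p + q + 1).factorial := by
  induction q generalizing p with
  | zero =>
    simp [integral_pow, Nat.factorial_succ]
    field_simp
  | succ q ih =>
    have hp : ((p : ℝ) + 1) ≠ 0 := by positivity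
    have key : ∫ t in (0 : ℝ)..1, ((p + 1 : ℝ) * (t ^ p * (1 - t) ^ (q + 1))
        - (q + 1 : ℝ) * (t ^ (p + 1) * (1 - t) ^ q)) = 0 := by
      have h : ∀ t ∈ Set.uIcc (0 : ℝ) 1, HasDerivAt (fun t : ℝ => t ^ (p + 1) * (1 - t) ^ (q + 1))
          ((p + 1 : ℝ) * (t ^ p * (1 - t) ^ (q + 1))
        - (q + 1 : ℝ) * (t ^ (p + 1) * (1 - t) ^ q)) t := by
        intro t _
        have h1 := hasDerivAt_pow (p + 1) t
        have h2 := ((hasDerivAt_id t).const_sub 1).pow (q + 1)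
        refine (h1.mul h2).congr_deriv ?_
        simp
        ring
      rw [intervalIntegral.integral_eq_sub_of_hasDerivAt h]
      · simp
      · apply Continuous.intervalIntegrable
        fun_prop
    rw [intervalIntegral.integral_sub (by apply Continuous.intervalIntegrable; fun_prop)
      (by apply Continuous.intervalIntegrable; fun_prop), intervalIntegral.integral_const_mul,
      intervalIntegral.integral_const_mul, ih (p + 1)] at key
    have e : p + 1 + q + 1 = p + (q + 1) + 1 := by ring
    rw [e] at key
    rw [sub_eq_zero] at key
    apply mul_left_cancel₀ hp
    rw [key]
    rw [Nat.factorial_succ p, Nat.factorial_succ q]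
    push_cast
    ring

lemma su11_altsum_zero (n c : ℕ) :
    ∑ k ∈ Finset.range (n + 1), (-1 : ℝ) ^ k * n.choose k *
      ((c + n - k).factorial / (c + 1 + n - k).factorial)
      = (-1) ^ n * n.factorial * c.factorial / (c + 1 + n).factorial := by
  have h1 : ∀ k ∈ Finset.range (n + 1), (-1 : ℝ) ^ k * n.choose k *
      ((c + n - k).factorial / (c + 1 + n - k).factorial)
      = ∫ t in (0 : ℝ)..1, t ^ c * ((-1) ^ k * t ^ (n - k) * n.choose k) := by
    intro k hk
    have hk' : k ≤ n := by simpa [Nat.lt_succ_iff] using hk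
    have e1 : ∀ t : ℝ, t ^ c * ((-1) ^ k * t ^ (n - k) * n.choose k)
      = ((-1) ^ k * n.choose k) * t ^ (c + (n - k)) := fun t => by ring
    simp_rw [e1]
    rw [intervalIntegral.integral_const_mul, integral_pow]
    have e2 : c + n - k = c + (n - k) := by omega
    have e3 : c + 1 + n - k = c + (n - k) + 1 := by omega
    rw [e2, e3, Nat.factorial_succ]
    have := Nat.factorial_ne_zero (c + (n - k))
    push_cast
    field_simp
    simp
  rw [Finset.sum_congr rfl h1, ← intervalIntegral.integral_finsetSum]
  · simp_rw [← Finset.mul_sum]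
    have : ∀ t : ℝ, t ^ c * ∑ k ∈ Finset.range (n + 1), (-1) ^ k * t ^ (n - k) * (n.choose k : ℝ)
        = (-1) ^ n * (t ^ c * (1 - t) ^ n) := by
      intro t
      rw [← add_pow, mul_left_comm, ← mul_pow]
      ring
    simp_rw [this]
    rw [intervalIntegral.integral_const_mul, su11_beta]
    rw [show c + n + 1 = c + 1 + n by ring]
    ring
  · intro k _
    apply Continuous.intervalIntegrable
    fun_prop

open fwdDiff in
lemma su11_altsum_pos (n c r : ℕ) (hr : r < n) :
    ∑ k ∈ Finset.range (n + 1), (-1 : ℝ) ^ k * n.choose k *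
      ((c + (r + 1) + n - k).factorial / (c + 1 + n - k).factorial)
      = 0 := by
  have h := Polynomial.fwdDiff_iter_eq_zero_of_degree_lt (R := ℝ) (P := ascPochhammer ℝ r) (n := n)
    (by rwa [ascPochhammer_natDegree])
  have h2 := congrFun h ((c + 2 : ℕ) : ℝ)
  rw [fwdDiff_iter_eq_sum_shift, ← Finset.sum_range_reflect] at h2
  refine Eq.trans ?_ h2
  apply Finset.sum_congr rfl
  intro k hk
  have hk' : k ≤ n := by simpa [Nat.lt_succ_iff] using hk
  obtain ⟨l, rfl⟩ := Nat.exists_eq_add_of_le hk'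
  have e1 : k + l + 1 - 1 - k = l := by omega
  have e2 : k + l - l = k := by omega
  have e3 : c + (r + 1) + (k + l) - k = c + 1 + l + r := by omega
  have e4 : c + 1 + (k + l) - k = c + 1 + l := by omega
  rw [e1, e2, e3, e4]
  have e5 : (((c + 2 : ℕ) : ℝ) + l • (1 : ℝ)) = ((c + 1 + l + 1 : ℕ) : ℝ) := by
    push_cast; simp; ring
  rw [e5, ← ascPochhammer_eval_cast, ascPochhammer_nat_eq_ascFactorial,
    ← Nat.factorial_mul_ascFactorial]
  have := Nat.factorial_ne_zero (c + 1 + l)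
  rw [Nat.choose_symm_add]
  push_cast
  simp
  field_simp
  simp

/-- moments -/
lemma su11_moment (n a c r : ℕ) (hr : r ≤ n) :
    ∫ t in (0 : ℝ)..1, t ^ c * (1 - t) ^ a * jacobiP n a (c + 1) (2 * t - 1) * t ^ r
      = if r = 0 then (-1 : ℝ) ^ n * (n + a).factorial * c.factorial / (a + c + 1 + n).factorial
        else 0 := by
  have e0 : ∀ t : ℝ, t ^ c * (1 - t) ^ a * jacobiP n a (c + 1) (2 * t - 1) * t ^ r
      = ∑ k ∈ Finset.range (n + 1), ((-1) ^ k * (Nat.choose (n + a) (n - k) : ℝ) *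
        (Nat.choose (n + (c + 1)) k : ℝ)) * (t ^ (c + r + (n - k)) * (1 - t) ^ (a + k)) := by
    intro t
    rw [jacobiP, Finset.mul_sum, Finset.sum_mul]
    apply Finset.sum_congr rfl
    intro k _
    rw [show (2 * t - 1 - 1) / 2 = (-1) * (1 - t) by ring, show (2 * t - 1 + 1) / 2 = t by ring,
      mul_pow]
    ring
  simp_rw [e0]
  rw [intervalIntegral.integral_finsetSum (fun k _ => by
    apply Continuous.intervalIntegrable; fun_prop)]
  have e1 : ∀ k ∈ Finset.range (n + 1),
      ∫ t in (0 : ℝ)..1, ((-1) ^ k * (Nat.choose (n + a) (n - k) : ℝ) *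
        (Nat.choose (n + (c + 1)) k : ℝ)) * (t ^ (c + r + (n - k)) * (1 - t) ^ (a + k))
      = (((n + a).factorial : ℝ) * (n + c + 1).factorial /
          (n.factorial * (c + r + n + a + 1).factorial)) * ((-1 : ℝ) ^ k * n.choose k *
      ((c + r + n - k).factorial / (c + 1 + n - k).factorial)) := by
    intro k hk
    have hk' : k ≤ n := by simpa [Nat.lt_succ_iff] using hk
    obtain ⟨l, rfl⟩ := Nat.exists_eq_add_of_le hk'
    rw [intervalIntegral.integral_const_mul, su11_beta,
      Nat.cast_choose ℝ (show k + l - k ≤ k + l + a by omega),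
      Nat.cast_choose ℝ (show k ≤ k + l + (c + 1) by omega),
      Nat.cast_choose ℝ (show k ≤ k + l by omega)]
    have e2 : k + l - k = l := by omega
    have e3 : k + l + a - l = a + k := by omega
    have e4 : k + l + (c + 1) - k = c + 1 + l := by omega
    have e5 : c + r + (k + l) - k = c + r + l := by omega
    have e6 : c + 1 + (k + l) - k = c + 1 + l := by omega
    have e7 : c + r + l + (a + k) + 1 = c + r + (k + l) + a + 1 := by omega
    have e8 : k + l + (c + 1) = k + l + c + 1 := by omega
    rw [e2, e3, e4, e5, e6, e7, e8]
    have f1 := Nat.factorial_ne_zero (a + k)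
    have f2 := Nat.factorial_ne_zero (k + l)
    have f3 := Nat.factorial_ne_zero l
    have f4 := Nat.factorial_ne_zero k
    field_simp
  rw [Finset.sum_congr rfl e1, ← Finset.mul_sum]
  rcases r with _ | r
  · simp only [add_zero, if_true]
    rw [su11_altsum_zero]
    rw [show c + n + a + 1 = a + c + 1 + n by ring, show c + 1 + n = n + c + 1 by ring]
    have f1 := Nat.factorial_ne_zero n
    have f2 := Nat.factorial_ne_zero (n + c + 1)
    field_simp
  · rw [su11_altsum_pos n c r (by omega)]
    simp

open Polynomial in
lemma su11_poly (n a c : ℕ) (q : ℝ[X]) (hq : q.natDegree ≤ n) :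
    ∫ t in (0 : ℝ)..1, t ^ c * (1 - t) ^ a * jacobiP n a (c + 1) (2 * t - 1) * q.eval t
      = q.eval 0 *
        ((-1) ^ n * (n + a).factorial * c.factorial / (a + c + 1 + n).factorial) := by
  have hc : Continuous (fun t : ℝ => jacobiP n a (c + 1) (2 * t - 1)) := by
    unfold jacobiP; fun_prop
  simp_rw [Polynomial.eval_eq_sum_range, Finset.mul_sum]
  rw [intervalIntegral.integral_finsetSum (fun k _ => by
    apply Continuous.intervalIntegrable; fun_prop)]
  rw [← Polynomial.eval_eq_sum_range, ← Polynomial.coeff_zero_eq_eval_zero]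
  simp_rw [mul_left_comm _ (q.coeff _) _, intervalIntegral.integral_const_mul]
  rw [Finset.sum_eq_single 0]
  · rw [su11_moment n a c 0 (by omega)]; simp
  · intro r hr h0
    rw [su11_moment n a c r (by simp at hr; omega)]
    simp [h0]
  · simp

open Polynomial in
lemma su11_jacobi_poly (n a b : ℕ) : ∃ q : ℝ[X], q.natDegree ≤ n ∧
    (∀ t : ℝ, q.eval t = jacobiP n a b (2 * t - 1)) ∧
    q.eval 0 = (-1) ^ n * (n + b).choose n := by
  have hq : ∀ t : ℝ, (∑ k ∈ Finset.range (n + 1), C ((Nat.choose (n + a) (n - k) : ℝ) *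
    (Nat.choose (n + b) k : ℝ)) * (X - 1) ^ k * X ^ (n - k)).eval t = jacobiP n a b (2 * t - 1) := by
    intro t
    simp only [eval_finsetSum, jacobiP]
    apply Finset.sum_congr rfl
    intro k _
    rw [show (2 * t - 1 - 1) / 2 = t - 1 by ring, show (2 * t - 1 + 1) / 2 = t by ring]
    simp
  refine ⟨∑ k ∈ Finset.range (n + 1), C ((Nat.choose (n + a) (n - k) : ℝ) *
    (Nat.choose (n + b) k : ℝ)) * (X - 1) ^ k * X ^ (n - k), ?_, hq, ?_⟩
  · apply natDegree_sum_le_of_forall_le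
    intro k hk
    have hk' : k ≤ n := by simpa [Nat.lt_succ_iff] using hk
    obtain ⟨l, rfl⟩ := Nat.exists_eq_add_of_le hk'
    rw [Nat.add_sub_cancel_left]
    refine natDegree_mul_le_of_le (natDegree_C_mul_le _ _ |>.trans ?_) (natDegree_X_pow_le _)
    refine (natDegree_pow_le_of_le (m := 1) k ?_).trans (by omega)
    exact natDegree_X_sub_C_le 1
  · rw [hq, jacobiP, Finset.sum_eq_single n]
    · norm_num; ring
    · intro k hk hkn
      have : n - k ≠ 0 := by simp at hk; omega
      norm_num [this]
    · simp

/-- The integral in the variable `t`. -/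
lemma su11_orth (m d a c : ℕ) :
    ∫ t in (0 : ℝ)..1, t ^ c * (1 - t) ^ a * jacobiP (m + d) a (c + 1) (2 * t - 1) *
      (t ^ d * jacobiP m a (c + 1 + 2 * d) (2 * t - 1))
      = if d = 0 then ((m + c + 1).factorial : ℝ) * (m + a).factorial /
          (m.factorial * (c + 1) * (a + c + 1 + m).factorial) else 0 := by
  obtain ⟨q, hq, he, h0⟩ := su11_jacobi_poly m a (c + 1 + 2 * d)
  have := su11_poly (m + d) a c (Polynomial.X ^ d * q) (by
    refine (Polynomial.natDegree_mul_le_of_le (Polynomial.natDegree_X_pow_le d) hq).trans ?_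
    omega)
  simp only [Polynomial.eval_mul, Polynomial.eval_pow, Polynomial.eval_X, he] at this
  rw [this]
  rcases d with _ | d
  · rw [he] at h0
    simp only [mul_zero, add_zero] at h0 ⊢
    norm_num at h0 ⊢
    rw [h0, Nat.cast_choose ℝ (show m ≤ m + (c + 1) by omega)]
    rw [Nat.add_sub_cancel_left, Nat.factorial_succ c, ← add_assoc]
    have f1 := Nat.factorial_ne_zero m
    have f2 := Nat.factorial_ne_zero c
    have : ((-1 : ℝ) ^ m) * (-1) ^ m = 1 := by rw [← mul_pow]; simp
    push_cast
    field_simp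
    linear_combination this
  · simp

/-- The real radial part of the matrix element. -/
noncomputable def su11Radial (twoEta k k' : ℕ) (x : ℝ) : ℝ :=
  (2 : ℝ) ^ (((k : ℝ) - (k' : ℝ)) / 2 - (twoEta : ℝ) / 2) *
      Real.sqrt (k.factorial * Real.Gamma ((twoEta : ℝ) + k') /
        (k'.factorial * Real.Gamma ((twoEta : ℝ) + k))) *
      (1 - x) ^ (((k' : ℝ) - (k : ℝ)) / 2) *
      (1 + x) ^ ((twoEta : ℝ) / 2) *
      jacobiP k (k' - k) (twoEta - 1) x

lemma su11_radial_aux (c m d a : ℕ) (K₁ K₂ J₁ J₂ t : ℝ) (h0 : 0 < t) (h1 : t < 1) :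
    ((2 : ℝ) ^ (((m : ℝ) - ((m + a : ℕ) : ℝ)) / 2 - ((c + 2 + 2 * d : ℕ) : ℝ) / 2) * K₁ *
      (1 - (2 * t - 1)) ^ ((((m + a : ℕ) : ℝ) - (m : ℝ)) / 2) *
      (1 + (2 * t - 1)) ^ (((c + 2 + 2 * d : ℕ) : ℝ) / 2) * J₁) *
    ((2 : ℝ) ^ ((((m + d : ℕ) : ℝ) - ((m + d + a : ℕ) : ℝ)) / 2 - ((c + 2 : ℕ) : ℝ) / 2) * K₂ *
      (1 - (2 * t - 1)) ^ ((((m + d + a : ℕ) : ℝ) - ((m + d : ℕ) : ℝ)) / 2) *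
      (1 + (2 * t - 1)) ^ (((c + 2 : ℕ) : ℝ) / 2) * J₂) * (1 + (2 * t - 1)) ^ (-2 : ℤ)
    = (K₁ * K₂ / 4) * (t ^ c * (1 - t) ^ a * J₂ * (t ^ d * J₁)) := by
  have hu : 0 < 1 + (2 * t - 1) := by linarith
  have hv : 0 < 1 - (2 * t - 1) := by linarith
  have a1 : (2 : ℝ) ^ (((m : ℝ) - ((m + a : ℕ) : ℝ)) / 2 - ((c + 2 + 2 * d : ℕ) : ℝ) / 2) *
      (2 : ℝ) ^ ((((m + d : ℕ) : ℝ) - ((m + d + a : ℕ) : ℝ)) / 2 - ((c + 2 : ℕ) : ℝ) / 2)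
      = ((2 : ℝ) ^ (a + c + 2 + d))⁻¹ := by
    rw [← Real.rpow_add two_pos, ← Real.rpow_natCast, ← Real.rpow_neg two_pos.le]
    congr 1
    push_cast
    ring
  have a2 : (1 - (2 * t - 1)) ^ ((((m + a : ℕ) : ℝ) - (m : ℝ)) / 2) *
      (1 - (2 * t - 1)) ^ ((((m + d + a : ℕ) : ℝ) - ((m + d : ℕ) : ℝ)) / 2)
      = (2 * (1 - t)) ^ a := by
    rw [← Real.rpow_add hv, ← Real.rpow_natCast]
    congr 1 <;> (push_cast; ring)
  have a3 : (1 + (2 * t - 1)) ^ (((c + 2 + 2 * d : ℕ) : ℝ) / 2) *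
      (1 + (2 * t - 1)) ^ (((c + 2 : ℕ) : ℝ) / 2) = (2 * t) ^ (c + 2 + d) := by
    rw [← Real.rpow_add hu, ← Real.rpow_natCast]
    congr 1 <;> (push_cast; ring)
  have a4 : (1 + (2 * t - 1)) ^ (-2 : ℤ) = ((2 * t) ^ 2)⁻¹ := by
    rw [zpow_neg]
    congr 1
    rw [show 1 + (2 * t - 1) = 2 * t by ring]
    norm_cast
  rw [a4]
  calc _ = ((2 : ℝ) ^ (((m : ℝ) - ((m + a : ℕ) : ℝ)) / 2 - ((c + 2 + 2 * d : ℕ) : ℝ) / 2) *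
      (2 : ℝ) ^ ((((m + d : ℕ) : ℝ) - ((m + d + a : ℕ) : ℝ)) / 2 - ((c + 2 : ℕ) : ℝ) / 2)) *
      ((1 - (2 * t - 1)) ^ ((((m + a : ℕ) : ℝ) - (m : ℝ)) / 2) *
      (1 - (2 * t - 1)) ^ ((((m + d + a : ℕ) : ℝ) - ((m + d : ℕ) : ℝ)) / 2)) *
      ((1 + (2 * t - 1)) ^ (((c + 2 + 2 * d : ℕ) : ℝ) / 2) *
      (1 + (2 * t - 1)) ^ (((c + 2 : ℕ) : ℝ) / 2)) * K₁ * K₂ * J₁ * J₂ * ((2 * t) ^ 2)⁻¹ := by ring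
    _ = _ := by
      rw [a1, a2, a3]
      simp only [mul_pow, pow_add]
      field_simp
      norm_num
      ring

lemma su11_radial_integral (c m d a : ℕ) :
    ∫ x in (-1 : ℝ)..1, su11Radial (c + 2 + 2 * d) m (m + a) x *
      su11Radial (c + 2) (m + d) (m + d + a) x * (1 + x) ^ (-2 : ℤ)
    = if d = 0 then 1 / (2 * ((c : ℝ) + 1)) else 0 := by
  have hs := intervalIntegral.integral_comp_mul_sub (a := 0) (b := 1)
    (fun x : ℝ => su11Radial (c + 2 + 2 * d) m (m + a) x *
      su11Radial (c + 2) (m + d) (m + d + a) x * (1 + x) ^ (-2 : ℤ)) (two_ne_zero) 1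
  norm_num at hs
  have hs' : ∫ x in (-1 : ℝ)..1, su11Radial (c + 2 + 2 * d) m (m + a) x *
      su11Radial (c + 2) (m + d) (m + d + a) x * (1 + x) ^ (-2 : ℤ)
     = 2 * ∫ t in (0 : ℝ)..1, su11Radial (c + 2 + 2 * d) m (m + a) (2 * t - 1) *
      su11Radial (c + 2) (m + d) (m + d + a) (2 * t - 1) * (1 + (2 * t - 1)) ^ (-2 : ℤ) := by
    norm_num
    rw [hs]
    ring
  rw [hs']
  have hc : ∀ t ∈ Set.Ioo (0 : ℝ) 1, su11Radial (c + 2 + 2 * d) m (m + a) (2 * t - 1) *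
      su11Radial (c + 2) (m + d) (m + d + a) (2 * t - 1) * (1 + (2 * t - 1)) ^ (-2 : ℤ)
      = (Real.sqrt (m.factorial * Real.Gamma (((c + 2 + 2 * d : ℕ) : ℝ) + (m + a : ℕ)) /
        ((m + a).factorial * Real.Gamma (((c + 2 + 2 * d : ℕ) : ℝ) + m))) *
        Real.sqrt ((m + d).factorial * Real.Gamma (((c + 2 : ℕ) : ℝ) + (m + d + a : ℕ)) /
        ((m + d + a).factorial * Real.Gamma (((c + 2 : ℕ) : ℝ) + (m + d : ℕ)))) / 4) *
        (t ^ c * (1 - t) ^ a * jacobiP (m + d) a (c + 1) (2 * t - 1) *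
      (t ^ d * jacobiP m a (c + 1 + 2 * d) (2 * t - 1))) := by
    intro t ht
    have e1 : m + a - m = a := by omega
    have e2 : m + d + a - (m + d) = a := by omega
    have e3 : c + 2 + 2 * d - 1 = c + 1 + 2 * d := by omega
    have e4 : c + 2 - 1 = c + 1 := by omega
    rw [su11Radial, su11Radial, e1, e2, e3, e4]
    exact su11_radial_aux c m d a _ _ _ _ t ht.1 ht.2
  rw [intervalIntegral.integral_of_le zero_le_one, MeasureTheory.integral_Ioc_eq_integral_Ioo,
    MeasureTheory.setIntegral_congr_fun measurableSet_Ioo hc,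
    ← MeasureTheory.integral_Ioc_eq_integral_Ioo, ← intervalIntegral.integral_of_le zero_le_one,
    intervalIntegral.integral_const_mul, su11_orth]
  rcases d with _ | d
  · simp only [mul_zero, add_zero, if_true]
    have g1 : Real.Gamma (((c + 2 : ℕ) : ℝ) + (m + a : ℕ)) = ((a + c + 1 + m).factorial : ℝ) := by
      rw [← Real.Gamma_nat_eq_factorial]; congr 1; push_cast; ring
    have g2 : Real.Gamma (((c + 2 : ℕ) : ℝ) + m) = ((m + c + 1).factorial : ℝ) := by
      rw [← Real.Gamma_nat_eq_factorial]; congr 1; push_cast; ring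
    rw [g1, g2, Real.mul_self_sqrt (by positivity)]
    have f1 := Nat.factorial_ne_zero m
    have f2 := Nat.factorial_ne_zero (m + a)
    have f3 := Nat.factorial_ne_zero (m + c + 1)
    have f4 := Nat.factorial_ne_zero (a + c + 1 + m)
    field_simp
    norm_num
  · simp

lemma su11_exp_integral (s : ℝ) (hs : s ≠ 0) (p q : ℝ) (k : ℤ)
    (hk : s * (q - p) = k * (2 * Real.pi)) :
    ∫ θ in p..q, Complex.exp (-Complex.I * (s : ℂ) * (θ : ℂ)) = 0 := by
  rw [integral_exp_mul_complex (by simp [hs])]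
  have : Complex.exp (-Complex.I * s * p) = Complex.exp (-Complex.I * s * q) := by
    rw [Complex.exp_eq_exp_iff_exists_int]
    refine ⟨k, ?_⟩
    have := congrArg (fun r : ℝ => (r : ℂ)) hk
    push_cast at this
    linear_combination Complex.I * this
  rw [this]; simp

lemma su11_conj_exp (s θ : ℝ) : (starRingEnd ℂ) (Complex.exp (-Complex.I * (s : ℂ) * (θ : ℂ)))
    = Complex.exp (Complex.I * (s : ℂ) * (θ : ℂ)) := by
  rw [← Complex.exp_conj]
  simp

lemma su11_integrand (N₁ N₂ m m' n n' : ℕ) (x φ ψ : ℝ) :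
    su11MatrixElement N₁ m m' x φ ψ *
              (starRingEnd ℂ) (su11MatrixElement N₂ n n' x φ ψ) *
              (((1 + x) ^ (-2 : ℤ) : ℝ) : ℂ)
    = ((-1) ^ (m' - m) * (-1) ^ (n' - n) * ((su11Radial N₁ m m' x * su11Radial N₂ n n' x *
        (1 + x) ^ (-2 : ℤ) : ℝ) : ℂ)) *
      (Complex.exp (-Complex.I * (((N₁ : ℝ) / 2 + m - ((N₂ : ℝ) / 2 + n) : ℝ) : ℂ) * (φ : ℂ)) *
      Complex.exp (-Complex.I * (((N₁ : ℝ) / 2 + m' - ((N₂ : ℝ) / 2 + n') : ℝ) : ℂ) * (ψ : ℂ))) := by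
  have e : ∀ s r θ : ℝ, Complex.exp (-Complex.I * ((s - r : ℝ) : ℂ) * (θ : ℂ)) =
      Complex.exp (-Complex.I * (s : ℂ) * (θ : ℂ)) * Complex.exp (Complex.I * (r : ℂ) * (θ : ℂ)) := by
    intro s r θ
    rw [← Complex.exp_add]
    congr 1
    push_cast
    ring
  rw [e, e, su11MatrixElement, su11MatrixElement]
  simp only [map_mul, su11_conj_exp, Complex.conj_ofReal, map_pow, map_neg, map_one]
  rw [← su11Radial, ← su11Radial]
  push_cast
  ring

/-- Orthogonality relations for matrix elements of the holomorphic discrete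
series of SU(1,1), in Cartan coordinates:
`∫ U^{η₁}_{mm′}(g) conj (U^{η₂}_{nn′}(g)) dHaar(g) = (2/(2η₁−1)) δ_{η₁η₂} δ_{mn} δ_{m′n′}`. -/
theorem su11_matrix_element_orthogonality
    (twoEta₁ twoEta₂ : ℕ) (h₁ : 2 ≤ twoEta₁) (h₂ : 2 ≤ twoEta₂)
    (m m' n n' : ℕ) (hm : m ≤ m') (hn : n ≤ n') :
    ((1 / (2 * Real.pi ^ 2) : ℝ) : ℂ) *
        ∫ x in (-1 : ℝ)..1, ∫ φ in (0 : ℝ)..(2 * Real.pi),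
          ∫ ψ in (-(2 * Real.pi) : ℝ)..(2 * Real.pi),
            su11MatrixElement twoEta₁ m m' x φ ψ *
              (starRingEnd ℂ) (su11MatrixElement twoEta₂ n n' x φ ψ) *
              (((1 + x) ^ (-2 : ℤ) : ℝ) : ℂ)
      = if twoEta₁ = twoEta₂ ∧ m = n ∧ m' = n'
          then ((2 / ((twoEta₁ : ℝ) - 1) : ℝ) : ℂ)
          else 0 := by
  simp_rw [su11_integrand, intervalIntegral.integral_const_mul,
    intervalIntegral.integral_mul_const, intervalIntegral.integral_const_mul]
  by_cases hB : (twoEta₁ : ℝ) / 2 + m' - ((twoEta₂ : ℝ) / 2 + n') = 0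
  swap
  · rw [su11_exp_integral _ hB _ _ ((twoEta₁ : ℤ) + 2 * m' - (twoEta₂ + 2 * n'))
      (by push_cast; ring), if_neg]
    · simp
    · rintro ⟨rfl, rfl, rfl⟩
      exact hB (by ring)
  by_cases hA : (twoEta₁ : ℝ) / 2 + m - ((twoEta₂ : ℝ) / 2 + n) = 0
  swap
  · have hA' : (twoEta₁ : ℝ) / 2 + m - ((twoEta₂ : ℝ) / 2 + n) =
      (((m : ℤ) - m' - (n - n') : ℤ) : ℝ) := by push_cast; linarith
    rw [su11_exp_integral _ hA _ _ ((m : ℤ) - m' - (n - n'))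
      (by rw [hA']; ring), if_neg]
    · simp
    · rintro ⟨rfl, rfl, rfl⟩
      exact hA (by ring)
  rw [hA, hB]
  have hA2 : twoEta₁ + 2 * m = twoEta₂ + 2 * n := by
    have : (twoEta₁ : ℝ) + 2 * m = twoEta₂ + 2 * n := by linarith
    exact_mod_cast this
  have hB2 : twoEta₁ + 2 * m' = twoEta₂ + 2 * n' := by
    have : (twoEta₁ : ℝ) + 2 * m' = twoEta₂ + 2 * n' := by linarith
    exact_mod_cast this
  obtain ⟨a, rfl⟩ := Nat.exists_eq_add_of_le hm
  obtain rfl : n' = n + a := by omega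
  have e1 : m + a - m = a := by omega
  have e2 : n + a - n = a := by omega
  have hsgn : ((-1 : ℂ)) ^ a * (-1) ^ a = 1 := by rw [← mul_pow]; simp
  rw [e1, e2, hsgn]
  have hpi : (Real.pi : ℂ) ≠ 0 := by exact_mod_cast Real.pi_ne_zero
  have key : ∫ x in (-1 : ℝ)..1, su11Radial twoEta₁ m (m + a) x *
      su11Radial twoEta₂ n (n + a) x * (1 + x) ^ (-2 : ℤ)
      = if twoEta₁ = twoEta₂ ∧ m = n ∧ m + a = n + a then 1 / (2 * ((twoEta₁ : ℝ) - 1)) else 0 := by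
    rcases le_total m n with hmn | hmn
    · obtain ⟨d, rfl⟩ := Nat.exists_eq_add_of_le hmn
      obtain ⟨c, rfl⟩ := Nat.exists_eq_add_of_le' h₂
      obtain rfl : twoEta₁ = c + 2 + 2 * d := by omega
      rw [su11_radial_integral]
      rcases d with _ | d
      · simp
        ring
      · simp
    · obtain ⟨d, rfl⟩ := Nat.exists_eq_add_of_le hmn
      obtain ⟨c, rfl⟩ := Nat.exists_eq_add_of_le' h₁
      obtain rfl : twoEta₂ = c + 2 + 2 * d := by omega
      have := su11_radial_integral c n d a
      simp_rw [mul_comm (su11Radial (c + 2 + 2 * d) n (n + a) _)] at this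
      rw [this]
      rcases d with _ | d
      · simp
        ring
      · simp
  simp only [one_mul, intervalIntegral.integral_ofReal]
  rw [key]
  split_ifs with h
  · have hN : (twoEta₁ : ℂ) - 1 ≠ 0 := by
      have : (2 : ℝ) ≤ twoEta₁ := by exact_mod_cast h₁
      have h3 : (twoEta₁ : ℝ) - 1 ≠ 0 := by linarith
      exact_mod_cast h3
    simp
    field_simp
    ring
  · simp
end

section
/- For a real parameter η, define the discrete-series character on the complexified torus by χ^{η}(θ) = e^{i(1−2η)θ/2} / (2i·sin(θ/2)), for θ ∈ ℂ with sin(θ/2) ≠ 0. Then for all real η₁, η₂ and all θ ∈ ℂ with Im θ < 0, the series Σ_{n=0}^{∞} χ^{η₁+η₂+n}(θ) converges absolutely and χ^{η₁}(θ)·χ^{η₂}(θ) = Σ_{n=0}^{∞} χ^{η₁+η₂+n}(θ). (This character identity encodes the tensor product decomposition U^{η₁} ⊗ U^{η₂} = ⊕_{n≥0} U^{η₁+η₂+n} of holomorphic discrete series of SU(1,1), each summand occurring with multiplicity one.) -/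
open Complex

/-- The character of the holomorphic discrete series representation `U^η` of
SU(1,1) on the (complexified) maximal torus:
`χ^η(θ) = e^{i(1−2η)θ/2}/(2i sin(θ/2))`. -/
noncomputable def dsChar (η : ℝ) (θ : ℂ) : ℂ :=
  Complex.exp (Complex.I * ((1 - 2 * η : ℝ) : ℂ) * θ / 2) /
    (2 * Complex.I * Complex.sin (θ / 2))

theorem dsChar_eq_aux (η : ℝ) (θ : ℂ) :
    dsChar η θ = Complex.exp (-(Complex.I * η * θ)) * (1 - Complex.exp (-(Complex.I * θ)))⁻¹ := by
  have h1 : 2 * Complex.I * Complex.sin (θ / 2)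
      = Complex.exp (Complex.I * θ / 2) * (1 - Complex.exp (-(Complex.I * θ))) := by
    rw [mul_sub, ← Complex.exp_add, Complex.sin]
    have e1 : Complex.I * θ / 2 + -(Complex.I * θ) = -(θ / 2) * Complex.I := by ring
    have e2 : Complex.I * θ / 2 = (θ / 2) * Complex.I := by ring
    rw [e1, e2]
    linear_combination (Complex.exp (-(θ / 2) * Complex.I)
      - Complex.exp ((θ / 2) * Complex.I)) * Complex.I_mul_I
  have h2 : Complex.exp (Complex.I * ((1 - 2 * η : ℝ) : ℂ) * θ / 2)
      = Complex.exp (Complex.I * θ / 2) * Complex.exp (-(Complex.I * η * θ)) := by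
    rw [← Complex.exp_add]
    congr 1
    push_cast
    ring
  rw [dsChar, h1, h2, mul_div_mul_left _ _ (Complex.exp_ne_zero _), div_eq_mul_inv]

/-- Character identity encoding the tensor product decomposition
`U^{η₁} ⊗ U^{η₂} = ⊕_{n≥0} U^{η₁+η₂+n}` of holomorphic discrete series of
SU(1,1), each summand occurring with multiplicity one:
`χ^{η₁}(θ) χ^{η₂}(θ) = Σ_{n≥0} χ^{η₁+η₂+n}(θ)` for `Im θ < 0`,
the series converging absolutely. -/
theorem su11_character_tensor_product
    (η₁ η₂ : ℝ) (θ : ℂ) (hθ : θ.im < 0) :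
    Summable (fun n : ℕ => ‖dsChar (η₁ + η₂ + n) θ‖) ∧
    dsChar η₁ θ * dsChar η₂ θ = ∑' n : ℕ, dsChar (η₁ + η₂ + n) θ := by
  set q := Complex.exp (-(Complex.I * θ)) with hq
  have hn : ‖q‖ < 1 := by
    rw [hq, Complex.norm_exp]
    simpa using hθ
  have ht : ∀ n : ℕ, dsChar (η₁ + η₂ + n) θ
      = Complex.exp (-(Complex.I * (η₁ + η₂) * θ)) * (1 - q)⁻¹ * q ^ n := by
    intro n
    have e : Complex.exp (-(Complex.I * ((η₁ + η₂ + n : ℝ) : ℂ) * θ))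
        = Complex.exp (-(Complex.I * (η₁ + η₂) * θ)) * q ^ n := by
      rw [hq, ← Complex.exp_nat_mul, ← Complex.exp_add]
      congr 1
      push_cast
      ring
    rw [dsChar_eq_aux, e]
    ring
  simp_rw [ht]
  constructor
  · simp_rw [norm_mul, norm_pow]
    exact (summable_geometric_of_lt_one (norm_nonneg _) hn).mul_left _
  · rw [tsum_mul_left, tsum_geometric_of_norm_lt_one hn, dsChar_eq_aux, dsChar_eq_aux, ← hq]
    have e : Complex.exp (-(Complex.I * (η₁ + η₂) * θ))
        = Complex.exp (-(Complex.I * η₁ * θ)) * Complex.exp (-(Complex.I * η₂ * θ)) := by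
      rw [← Complex.exp_add]
      congr 1
      ring
    rw [e]
    ring
end
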